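/- Let (X,d) be a compact metric space, T : X → X a continuous map, and φ ∈ C(X,ℝ). Then sup_{x∈X} inf_{n∈ℕ, n≥1} S_nφ(x)/n = sup_{x∈X} liminf_{n→∞} S_nφ(x)/n. -/

import Mathlib

open MeasureTheory Filter Topology

/-- The Birkhoff sum `S_n φ(x) = ∑_{i=0}^{n-1} φ(T^i x)`. -/
noncomputable def birkhoffAvgSum {X : Type*} [TopologicalSpace X] (T : X → X) (φ : C(X, ℝ)) (n : ℕ) (x : X) : ℝ :=
  ∑ i ∈ Finset.range n, φ (T^[i] x)

/-- The maximum ergodic average `α(φ) = sup_{μ ∈ M_T(X)} ∫ φ dμ`. -/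
noncomputable def maxErgAvg {X : Type*} [MetricSpace X] [MeasurableSpace X] [BorelSpace X]
    (T : X → X) (φ : C(X, ℝ)) : ℝ :=
  sSup {r : ℝ | ∃ μ : Measure X, IsProbabilityMeasure μ ∧ μ.map T = μ ∧ r = ∫ x, φ x ∂μ}

theorem abs_avg_le {X : Type*} [TopologicalSpace X] [CompactSpace X]
    (T : X → X) (φ : C(X, ℝ)) (n : ℕ) (x : X) :
    |birkhoffAvgSum T φ n x / n| ≤ ‖φ‖ := by
  have h : |birkhoffAvgSum T φ n x| ≤ n * ‖φ‖ := by
    unfold birkhoffAvgSum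
    refine (Finset.abs_sum_le_sum_abs _ _).trans ?_
    refine (Finset.sum_le_sum (fun i _ => φ.norm_coe_le_norm (T^[i] x))).trans ?_
    simp
  rw [abs_div, Nat.abs_cast]
  rcases Nat.eq_zero_or_pos n with rfl | hn
  · simp
  · have hn' : (0 : ℝ) < n := by exact_mod_cast hn
    rw [div_le_iff₀ hn']
    linarith

theorem avgSum_add {X : Type*} [TopologicalSpace X]
    (T : X → X) (φ : C(X, ℝ)) (m n : ℕ) (x : X) :
    birkhoffAvgSum T φ (m + n) x = birkhoffAvgSum T φ m x + birkhoffAvgSum T φ n (T^[m] x) := by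
  unfold birkhoffAvgSum
  rw [Finset.sum_range_add]
  congr 1
  refine Finset.sum_congr rfl fun i _ => ?_
  rw [← Function.iterate_add_apply, Nat.add_comm]

/-- Pliss-type argument: restart the orbit at a minimum of `S_n φ(x) - c n`. -/
theorem exists_good_point {X : Type*} [TopologicalSpace X]
    (T : X → X) (φ : C(X, ℝ)) (x : X) (c : ℝ)
    (h : ∀ᶠ n : ℕ in atTop, c < birkhoffAvgSum T φ n x / n) :
    ∃ y, ∀ n : ℕ+, c ≤ birkhoffAvgSum T φ n y / n := by
  obtain ⟨K, hK⟩ := eventually_atTop.1 h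
  let g : ℕ → ℝ := fun n => birkhoffAvgSum T φ n x - c * n
  have g0 : g 0 = 0 := by simp [g, birkhoffAvgSum]
  obtain ⟨N, _, hmin⟩ := Finset.exists_min_image (Finset.range (K + 1)) g ⟨0, by simp⟩
  have hall : ∀ n, g N ≤ g n := by
    intro n
    by_cases hn : n < K + 1
    · exact hmin n (by simpa using hn)
    · have h1 := hK n (by omega)
      have hn' : (0 : ℝ) < n := by
        have : 0 < n := by omega
        exact_mod_cast this
      rw [lt_div_iff₀ hn'] at h1
      have h2 := hmin 0 (by simp)
      have h3 : 0 ≤ g n := by simp only [g]; linarith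
      linarith
  refine ⟨T^[N] x, fun n => ?_⟩
  have hn' : (0 : ℝ) < ((n : ℕ) : ℝ) := by exact_mod_cast n.pos
  rw [le_div_iff₀ hn']
  have h1 := hall (N + n)
  simp only [g, avgSum_add] at h1
  push_cast at h1
  linarith

/-- `sup_{x∈X} inf_{n≥1} S_nφ(x)/n = sup_{x∈X} liminf_{n→∞} S_nφ(x)/n`. -/
theorem sup_inf_eq_sup_liminf {X : Type*} [MetricSpace X] [CompactSpace X] [Nonempty X]
    (T : X → X) (hT : Continuous T) (φ : C(X, ℝ)) :
    ⨆ x : X, ⨅ n : ℕ+, birkhoffAvgSum T φ n x / n =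
      ⨆ x : X, liminf (fun n : ℕ => birkhoffAvgSum T φ n x / n) atTop := by
  have hlow : ∀ (n : ℕ) (x : X), -‖φ‖ ≤ birkhoffAvgSum T φ n x / n :=
    fun n x => (abs_le.1 (abs_avg_le T φ n x)).1
  have hup : ∀ (n : ℕ) (x : X), birkhoffAvgSum T φ n x / n ≤ ‖φ‖ :=
    fun n x => (abs_le.1 (abs_avg_le T φ n x)).2
  have hbi : ∀ x : X, BddBelow (Set.range fun n : ℕ+ => birkhoffAvgSum T φ n x / n) :=
    fun x => ⟨-‖φ‖, by rintro _ ⟨n, rfl⟩; exact hlow n x⟩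
  have hB : ∀ x : X, IsBoundedUnder (· ≥ ·) atTop
      (fun n : ℕ => birkhoffAvgSum T φ n x / n) :=
    fun x => isBoundedUnder_of ⟨-‖φ‖, fun n => hlow n x⟩
  have hA : ∀ x : X, IsBoundedUnder (· ≤ ·) atTop
      (fun n : ℕ => birkhoffAvgSum T φ n x / n) :=
    fun x => isBoundedUnder_of ⟨‖φ‖, fun n => hup n x⟩
  have hbs1 : BddAbove (Set.range fun x : X => ⨅ n : ℕ+, birkhoffAvgSum T φ n x / n) :=
    ⟨‖φ‖, by rintro _ ⟨x, rfl⟩; exact (ciInf_le (hbi x) 1).trans (hup _ x)⟩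
  have hbs2 : BddAbove (Set.range fun x : X =>
      liminf (fun n : ℕ => birkhoffAvgSum T φ n x / n) atTop) :=
    ⟨‖φ‖, by
      rintro _ ⟨x, rfl⟩
      exact liminf_le_of_frequently_le (Frequently.of_forall fun n => hup n x) (hB x)⟩
  apply le_antisymm
  · refine ciSup_le fun x => le_trans ?_ (le_ciSup hbs2 x)
    refine le_liminf_of_le (hA x).isCoboundedUnder_ge ?_
    filter_upwards [eventually_gt_atTop 0] with n hn
    exact ciInf_le (hbi x) ⟨n, hn⟩
  · refine ciSup_le fun x => le_of_forall_lt fun c hc => ?_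
    obtain ⟨c', hc', hc''⟩ := exists_between hc
    obtain ⟨y, hy⟩ := exists_good_point T φ x c' (eventually_lt_of_lt_liminf hc'' (hB x))
    exact hc'.trans_le ((le_ciInf hy).trans (le_ciSup hbs1 y))
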